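/- Let A and X be complex m×n matrices and let ξ ∈ ℂⁿ be a unit vector (‖ξ‖₂ = 1) with all entries real and nonnegative such that X = A Δ(ξ). Then (A, ξ) is the cb operator factorization of X if and only if (ξ, A*A, ξ) is the cb bilinear form factorization of X*X, i.e. X*X = Δ(ξ) (A*A) Δ(ξ) is the cb bilinear form factorization of X*X. -/

import Mathlib

open Matrix
open scoped ComplexOrder

noncomputable section

namespace MatFact

/-- ℓ² norm of a complex vector. -/
def vnorm {n : ℕ} (v : Fin n → ℂ) : ℝ := Real.sqrt (∑ j, ‖v j‖ ^ 2)

/-- Operator norm of a matrix as a map ℓ²(Fin n) → ℓ²(Fin m). -/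
def opNorm {m n : ℕ} (X : Matrix (Fin m) (Fin n) ℂ) : ℝ :=
  sSup {c : ℝ | ∃ v : Fin n → ℂ, vnorm v ≤ 1 ∧ c = vnorm (X.mulVec v)}

/-- Column norm: the maximal ℓ² norm of a column. -/
def colNorm {m n : ℕ} (X : Matrix (Fin m) (Fin n) ℂ) : ℝ :=
  ⨆ j : Fin n, vnorm (fun i => X i j)

/-- Hilbert–Schmidt (Frobenius) norm. -/
def frobNorm {m n : ℕ} (X : Matrix (Fin m) (Fin n) ℂ) : ℝ :=
  Real.sqrt (∑ i, ∑ j, ‖X i j‖ ^ 2)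

/-- Schur norm: operator norm of Schur (entrywise) multiplication by `X`
on matrices with the operator norm. -/
def schurNorm {m n : ℕ} (X : Matrix (Fin m) (Fin n) ℂ) : ℝ :=
  sSup {c : ℝ | ∃ A : Matrix (Fin m) (Fin n) ℂ, opNorm A ≤ 1 ∧
    c = opNorm (Matrix.hadamard X A)}

/-- The T-norm (bilinear Schur norm). -/
def Tnorm {m n : ℕ} (X : Matrix (Fin m) (Fin n) ℂ) : ℝ :=
  sSup {c : ℝ | ∃ (a : Fin m → ℂ) (B : Matrix (Fin m) (Fin n) ℂ),
    (∀ i, ‖a i‖ ≤ 1) ∧ opNorm B ≤ 1 ∧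
    c = vnorm (fun j => ∑ i, a i * X i j * B i j)}

/-- The F-norm: operator norm of `X` from `ℂⁿ` with the sup norm to `ℂᵐ`
with the ℓ² norm. -/
def Fnorm {m n : ℕ} (X : Matrix (Fin m) (Fin n) ℂ) : ℝ :=
  sSup {c : ℝ | ∃ v : Fin n → ℂ, (∀ j, ‖v j‖ ≤ 1) ∧ c = vnorm (X.mulVec v)}

/-- The bilinear form norm. -/
def Bnorm {m n : ℕ} (Y : Matrix (Fin m) (Fin n) ℂ) : ℝ :=
  sSup {c : ℝ | ∃ (a : Fin m → ℂ) (b : Fin n → ℂ), (∀ i, ‖a i‖ ≤ 1) ∧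
    (∀ j, ‖b j‖ ≤ 1) ∧ c = ‖∑ i, ∑ j, Y i j * a i * b j‖}

/-- The completely bounded F-norm. -/
def cbF {m n : ℕ} (X : Matrix (Fin m) (Fin n) ℂ) : ℝ :=
  sInf {c : ℝ | ∃ (A : Matrix (Fin m) (Fin n) ℂ) (ξ : Fin n → ℂ),
    X = A * Matrix.diagonal ξ ∧ c = opNorm A * vnorm ξ}

/-- The completely bounded bilinear form norm. -/
def cbB {m n : ℕ} (X : Matrix (Fin m) (Fin n) ℂ) : ℝ :=
  sInf {c : ℝ | ∃ (η : Fin m → ℂ) (B : Matrix (Fin m) (Fin n) ℂ) (ξ : Fin n → ℂ),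
    X = Matrix.diagonal η * B * Matrix.diagonal ξ ∧
    c = vnorm η * opNorm B * vnorm ξ}

/-- The range (column space) of a matrix, as a submodule of `ℂᵐ`. -/
def ran {m n : ℕ} (X : Matrix (Fin m) (Fin n) ℂ) : Submodule ℂ (Fin m → ℂ) :=
  LinearMap.range X.mulVecLin

/-- `P` is the orthogonal projection onto the subspace `E`, i.e. `P` is a
Hermitian idempotent with range `E`. -/
def IsOrthProjOnto {n : ℕ} (P : Matrix (Fin n) (Fin n) ℂ)
    (E : Submodule ℂ (Fin n → ℂ)) : Prop :=
  P.IsHermitian ∧ P * P = P ∧ ran P = E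

/-- `W` is a partial isometry with support `E` and range `F`. -/
def IsPartialIsometryFromTo {m n : ℕ} (W : Matrix (Fin m) (Fin n) ℂ)
    (E : Submodule ℂ (Fin n → ℂ)) (F : Submodule ℂ (Fin m → ℂ)) : Prop :=
  IsOrthProjOnto (Wᴴ * W) E ∧ IsOrthProjOnto (W * Wᴴ) F

/-- A cb operator factorization of `X`. -/
def IsCbOpFact {m n : ℕ} (X A : Matrix (Fin m) (Fin n) ℂ) (ξ : Fin n → ℂ) : Prop :=
  (∀ j, 0 ≤ ξ j) ∧ vnorm ξ = 1 ∧ opNorm A = cbF X ∧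
  (∀ j, ξ j = 0 → ∀ i, A i j = 0) ∧ X = A * Matrix.diagonal ξ

/-- A cb bilinear form factorization of `X`. -/
def IsCbBilFact {m n : ℕ} (X : Matrix (Fin m) (Fin n) ℂ) (η : Fin m → ℂ)
    (B : Matrix (Fin m) (Fin n) ℂ) (ξ : Fin n → ℂ) : Prop :=
  (∀ i, 0 ≤ η i) ∧ (∀ j, 0 ≤ ξ j) ∧ vnorm η = 1 ∧ vnorm ξ = 1 ∧
  opNorm B = cbB X ∧ (∀ j, ξ j = 0 → ∀ i, B i j = 0) ∧
  (∀ i, η i = 0 → ∀ j, B i j = 0) ∧ X = Matrix.diagonal η * B * Matrix.diagonal ξ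

/-- A Schur factorization of `X`. -/
def IsSchurFact {m n : ℕ} (X : Matrix (Fin m) (Fin n) ℂ)
    (F : Matrix (Fin m) (Fin m) ℂ) (W : Matrix (Fin m) (Fin n) ℂ)
    (G : Matrix (Fin n) (Fin n) ℂ) : Prop :=
  F.PosSemidef ∧ (∀ i, (F * F) i i ≤ 1) ∧ G.PosSemidef ∧ (∀ j, (G * G) j j ≤ 1) ∧
  IsPartialIsometryFromTo W (ran G) (ran F) ∧
  X = (schurNorm X : ℂ) • (F * W * G)

/-- A bilinear Schur factorization of `X`. -/
def IsBilinSchurFact {m n : ℕ} (X : Matrix (Fin m) (Fin n) ℂ)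
    (T : Matrix (Fin m) (Fin m) ℂ) (W : Matrix (Fin m) (Fin n) ℂ)
    (G : Matrix (Fin n) (Fin n) ℂ) : Prop :=
  T.PosSemidef ∧ frobNorm T = Tnorm X ∧ G.PosSemidef ∧ (∀ j, (G * G) j j ≤ 1) ∧
  IsPartialIsometryFromTo W (ran G) (ran T) ∧ X = T * W * G

/-- Maximal diagonal entry (real part) of a square matrix. -/
def maxDiag {n : ℕ} (P : Matrix (Fin n) (Fin n) ℂ) : ℝ := ⨆ i, (P i i).re

end MatFact

namespace MatFact

open scoped Matrix.Norms.L2Operator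

lemma vnorm_eq_norm {n : ℕ} (v : Fin n → ℂ) : vnorm v = ‖WithLp.toLp 2 v‖ := by
  simp [vnorm, EuclideanSpace.norm_eq]

lemma vnorm_nonneg {n : ℕ} (v : Fin n → ℂ) : 0 ≤ vnorm v := Real.sqrt_nonneg _

lemma vnorm_sq {n : ℕ} (v : Fin n → ℂ) : vnorm v ^ 2 = ∑ j, ‖v j‖ ^ 2 :=
  Real.sq_sqrt (Finset.sum_nonneg fun _ _ => sq_nonneg _)

lemma eq_zero_of_vnorm_eq_zero {n : ℕ} {v : Fin n → ℂ} (h : vnorm v = 0) : v = 0 := by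
  rw [vnorm_eq_norm, norm_eq_zero] at h
  simpa using h

lemma vnorm_star {n : ℕ} (v : Fin n → ℂ) : vnorm (star v) = vnorm v := by
  simp [vnorm]

lemma opNorm_eq_norm {m n : ℕ} (X : Matrix (Fin m) (Fin n) ℂ) : opNorm X = ‖X‖ := by
  rw [Matrix.l2_opNorm_def, ← ContinuousLinearMap.sSup_unitClosedBall_eq_norm, opNorm]
  congr 1
  ext c
  constructor
  · rintro ⟨v, hv, rfl⟩
    exact ⟨WithLp.toLp 2 v, by simpa [vnorm_eq_norm] using hv, by
      simp [vnorm_eq_norm, Matrix.toLpLin_toLp]⟩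
  · rintro ⟨v, hv, rfl⟩
    exact ⟨v.ofLp, by simpa [vnorm_eq_norm] using hv, by
      simp [vnorm_eq_norm, Matrix.toLpLin_apply]⟩

lemma opNorm_nonneg {m n : ℕ} (X : Matrix (Fin m) (Fin n) ℂ) : 0 ≤ opNorm X := by
  rw [opNorm_eq_norm]
  exact norm_nonneg _

lemma opNorm_conjTranspose_mul_self {m n : ℕ} (A : Matrix (Fin m) (Fin n) ℂ) :
    opNorm (Aᴴ * A) = opNorm A ^ 2 := by
  rw [opNorm_eq_norm, opNorm_eq_norm, Matrix.l2_opNorm_conjTranspose_mul_self, sq]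

lemma vnorm_mulVec_le {m n : ℕ} (X : Matrix (Fin m) (Fin n) ℂ) (v : Fin n → ℂ) :
    vnorm (X *ᵥ v) ≤ opNorm X * vnorm v := by
  rw [opNorm_eq_norm, vnorm_eq_norm, vnorm_eq_norm]
  exact Matrix.l2_opNorm_mulVec X (WithLp.toLp 2 v)

lemma opNorm_le_of_forall {m n : ℕ} {X : Matrix (Fin m) (Fin n) ℂ} {C : ℝ} (hC : 0 ≤ C)
    (h : ∀ v, vnorm (X *ᵥ v) ≤ C * vnorm v) : opNorm X ≤ C := by
  refine csSup_le ⟨_, 0, by simp [vnorm], rfl⟩ ?_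
  rintro _ ⟨v, hv, rfl⟩
  exact (h v).trans (mul_le_of_le_one_right hC hv)

lemma norm_star_dotProduct_le {n : ℕ} (v w : Fin n → ℂ) :
    ‖star v ⬝ᵥ w‖ ≤ vnorm v * vnorm w := by
  have h := norm_inner_le_norm (𝕜 := ℂ) (WithLp.toLp 2 v) (WithLp.toLp 2 w)
  rw [EuclideanSpace.inner_eq_star_dotProduct] at h
  rw [vnorm_eq_norm, vnorm_eq_norm, dotProduct_comm]
  exact h

lemma star_dotProduct_self {n : ℕ} (v : Fin n → ℂ) :
    star v ⬝ᵥ v = ((vnorm v ^ 2 : ℝ) : ℂ) := by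
  rw [vnorm_sq, dotProduct]
  push_cast
  exact Finset.sum_congr rfl fun j _ => by
    rw [Pi.star_apply, RCLike.star_def, Complex.conj_mul']

lemma cbF_nonneg {m n : ℕ} (X : Matrix (Fin m) (Fin n) ℂ) : 0 ≤ cbF X := by
  refine Real.sInf_nonneg ?_
  rintro _ ⟨A, ξ, -, rfl⟩
  exact mul_nonneg (opNorm_nonneg A) (vnorm_nonneg ξ)

lemma cbF_le {m n : ℕ} (A : Matrix (Fin m) (Fin n) ℂ) (ξ : Fin n → ℂ) :
    cbF (A * diagonal ξ) ≤ opNorm A * vnorm ξ := by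
  refine csInf_le ⟨0, ?_⟩ ⟨A, ξ, rfl, rfl⟩
  rintro _ ⟨A, ξ, -, rfl⟩
  exact mul_nonneg (opNorm_nonneg A) (vnorm_nonneg ξ)

lemma cbB_le {m n : ℕ} (η : Fin m → ℂ) (B : Matrix (Fin m) (Fin n) ℂ) (ξ : Fin n → ℂ) :
    cbB (diagonal η * B * diagonal ξ) ≤ vnorm η * opNorm B * vnorm ξ := by
  refine csInf_le ⟨0, ?_⟩ ⟨η, B, ξ, rfl, rfl⟩
  rintro _ ⟨η, B, ξ, -, rfl⟩
  exact mul_nonneg (mul_nonneg (vnorm_nonneg η) (opNorm_nonneg B)) (vnorm_nonneg ξ)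

/-- A diagonal domination `‖X v‖² ≤ ∑ wⱼ |vⱼ|²` bounds the cbF-norm. -/
lemma cbF_sq_le_sum {m n : ℕ} (X : Matrix (Fin m) (Fin n) ℂ) (w : Fin n → ℝ)
    (hw : ∀ j, 0 ≤ w j) (h : ∀ v, vnorm (X *ᵥ v) ^ 2 ≤ ∑ j, w j * ‖v j‖ ^ 2) :
    cbF X ^ 2 ≤ ∑ j, w j := by
  set ζ : Fin n → ℂ := fun j => (Real.sqrt (w j) : ℂ) with hζ
  have hnorm : ∀ j, ‖ζ j‖ ^ 2 = w j := fun j => by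
    simp [hζ, abs_of_nonneg (Real.sqrt_nonneg _), Real.sq_sqrt (hw j)]
  have hcol : ∀ j, ζ j = 0 → ∀ i, X i j = 0 := fun j hj i => by
    have hwj : w j = 0 := by rw [← hnorm j, hj]; simp
    have hle := h (Pi.single j 1)
    rw [Finset.sum_eq_zero (fun k _ => by
      by_cases hk : k = j
      · subst hk; simp [hwj]
      · simp [hk])] at hle
    have h0 : vnorm (X *ᵥ Pi.single j 1) = 0 := by
      have := sq_nonneg (vnorm (X *ᵥ Pi.single j 1))
      exact pow_eq_zero_iff two_ne_zero |>.1 (le_antisymm hle this)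
    simpa using congrFun (eq_zero_of_vnorm_eq_zero h0) i
  have hX : X = (X * diagonal ζ⁻¹) * diagonal ζ := by
    ext i j
    rw [mul_diagonal, mul_diagonal, Pi.inv_apply]
    by_cases hj : ζ j = 0
    · simp [hj, hcol j hj i]
    · field_simp
  have hA : opNorm (X * diagonal ζ⁻¹) ≤ 1 := by
    refine opNorm_le_of_forall zero_le_one fun v => ?_
    rw [one_mul]
    refine le_of_sq_le_sq ?_ (vnorm_nonneg v)
    rw [← mulVec_mulVec]
    refine (h _).trans ?_
    rw [vnorm_sq]
    refine Finset.sum_le_sum fun j _ => ?_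
    rw [mulVec_diagonal, Pi.inv_apply, norm_mul, norm_inv, mul_pow, inv_pow, hnorm, ← mul_assoc]
    exact mul_le_of_le_one_left (sq_nonneg _) (mul_inv_le_one)
  have hle : cbF X ≤ vnorm ζ := by
    have := cbF_le (X * diagonal ζ⁻¹) ζ
    rw [← hX] at this
    exact this.trans (mul_le_of_le_one_left (vnorm_nonneg ζ) hA)
  calc cbF X ^ 2 ≤ vnorm ζ ^ 2 := pow_le_pow_left₀ (cbF_nonneg X) hle 2
    _ = ∑ j, w j := by rw [vnorm_sq]; exact Finset.sum_congr rfl fun j _ => hnorm j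

lemma cbF_sq_le {m n : ℕ} (X : Matrix (Fin m) (Fin n) ℂ) (η ξ : Fin n → ℂ)
    (B : Matrix (Fin n) (Fin n) ℂ) (hX : Xᴴ * X = diagonal η * B * diagonal ξ) :
    cbF X ^ 2 ≤ vnorm η * opNorm B * vnorm ξ := by
  have hform : ∀ v, vnorm (X *ᵥ v) ^ 2 ≤
      opNorm B * (vnorm (star η * v) * vnorm (ξ * v)) := fun v => by
    have hdiag : ∀ (d u : Fin n → ℂ), diagonal d *ᵥ u = d * u := fun d u =>
      funext fun j => mulVec_diagonal d u j
    have hstar : star (X *ᵥ v) ⬝ᵥ (X *ᵥ v) = star (star η * v) ⬝ᵥ (B *ᵥ (ξ * v)) := by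
      rw [star_mulVec, ← dotProduct_mulVec, mulVec_mulVec, hX, ← mulVec_mulVec, ← mulVec_mulVec,
        hdiag, hdiag]
      refine Finset.sum_congr rfl fun j _ => ?_
      simp only [Pi.star_apply, Pi.mul_apply, star_mul', star_star]
      ring
    have hn : vnorm (X *ᵥ v) ^ 2 = ‖star (X *ᵥ v) ⬝ᵥ (X *ᵥ v)‖ := by
      rw [star_dotProduct_self, Complex.norm_real, Real.norm_of_nonneg (sq_nonneg _)]
    rw [hn, hstar]
    calc _ ≤ vnorm (star η * v) * vnorm (B *ᵥ (ξ * v)) := norm_star_dotProduct_le _ _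
      _ ≤ vnorm (star η * v) * (opNorm B * vnorm (ξ * v)) :=
        mul_le_mul_of_nonneg_left (vnorm_mulVec_le _ _) (vnorm_nonneg _)
      _ = _ := by ring
  by_cases h0 : vnorm η = 0 ∨ vnorm ξ = 0
  · have hz : ∀ v, vnorm (X *ᵥ v) ^ 2 ≤ ∑ j : Fin n, (0 : ℝ) * ‖v j‖ ^ 2 := fun v => by
      refine (hform v).trans (le_of_eq ?_)
      rcases h0 with h0 | h0 <;> simp [eq_zero_of_vnorm_eq_zero h0, vnorm]
    have := cbF_sq_le_sum X (fun _ => 0) (fun _ => le_rfl) hz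
    rcases h0 with h0 | h0 <;> simpa [h0] using this
  · obtain ⟨hη, hξ⟩ := not_or.1 h0
    have hη' := (vnorm_nonneg η).lt_of_ne' hη
    have hξ' := (vnorm_nonneg ξ).lt_of_ne' hξ
    set t := vnorm η / vnorm ξ with ht
    have ht0 : 0 < t := div_pos hη' hξ'
    have hB := opNorm_nonneg B
    refine (cbF_sq_le_sum X
      (fun j => opNorm B * ((t * ‖ξ j‖ ^ 2 + t⁻¹ * ‖η j‖ ^ 2) / 2)) (fun j => by positivity)
      fun v => ?_).trans (le_of_eq ?_)
    · have hsum : ∑ j, opNorm B * ((t * ‖ξ j‖ ^ 2 + t⁻¹ * ‖η j‖ ^ 2) / 2) * ‖v j‖ ^ 2 =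
          opNorm B * ((t * vnorm (ξ * v) ^ 2 + t⁻¹ * vnorm (star η * v) ^ 2) / 2) := by
        rw [vnorm_sq, vnorm_sq, Finset.mul_sum, Finset.mul_sum, ← Finset.sum_add_distrib,
          Finset.sum_div, Finset.mul_sum]
        refine Finset.sum_congr rfl fun j _ => ?_
        simp only [Pi.mul_apply, Pi.star_apply, norm_mul, norm_star]
        ring
      rw [hsum]
      refine (hform v).trans (mul_le_mul_of_nonneg_left ?_ hB)
      generalize vnorm (star η * v) = a
      generalize vnorm (ξ * v) = b
      have hsq : (t * b ^ 2 + t⁻¹ * a ^ 2) / 2 - a * b = t⁻¹ * (t * b - a) ^ 2 / 2 := by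
        field_simp
        ring
      have : 0 ≤ t⁻¹ * (t * b - a) ^ 2 / 2 := by positivity
      linarith
    · rw [← Finset.mul_sum, ← Finset.sum_div, Finset.sum_add_distrib, ← Finset.mul_sum,
        ← Finset.mul_sum, ← vnorm_sq, ← vnorm_sq, ht]
      field_simp
      ring

lemma conjTranspose_mul_self_of_eq_mul_diagonal {m n : ℕ} (A : Matrix (Fin m) (Fin n) ℂ)
    (ξ : Fin n → ℂ) :
    (A * diagonal ξ)ᴴ * (A * diagonal ξ) = diagonal (star ξ) * (Aᴴ * A) * diagonal ξ := by
  rw [conjTranspose_mul, diagonal_conjTranspose]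
  simp only [Matrix.mul_assoc]

lemma cbB_conjTranspose_mul_self {m n : ℕ} (X : Matrix (Fin m) (Fin n) ℂ) :
    cbB (Xᴴ * X) = cbF X ^ 2 := by
  refine le_antisymm ?_ ?_
  · refine Real.sqrt_le_left (cbF_nonneg X) |>.1 ?_
    refine le_csInf ⟨_, X, 1, by simp, rfl⟩ ?_
    rintro _ ⟨A, ξ, rfl, rfl⟩
    refine Real.sqrt_le_left (mul_nonneg (opNorm_nonneg A) (vnorm_nonneg ξ)) |>.2 ?_
    rw [conjTranspose_mul_self_of_eq_mul_diagonal]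
    refine (cbB_le _ _ _).trans (le_of_eq ?_)
    rw [vnorm_star, opNorm_conjTranspose_mul_self]
    ring
  · refine le_csInf ⟨_, 1, Xᴴ * X, 1, by simp, rfl⟩ ?_
    rintro _ ⟨η, B, ξ, h, rfl⟩
    exact cbF_sq_le X η ξ B h

theorem stmt18 {m n : ℕ} (A X : Matrix (Fin m) (Fin n) ℂ) (ξ : Fin n → ℂ)
    (hξ : ∀ j, 0 ≤ ξ j) (hξ2 : vnorm ξ = 1) (hX : X = A * Matrix.diagonal ξ) :
    IsCbOpFact X A ξ ↔ IsCbBilFact (Xᴴ * X) ξ (Aᴴ * A) ξ := by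
  have hstar : star ξ = ξ := funext fun j => (IsSelfAdjoint.of_nonneg (hξ j)).star_eq
  have hfact : Xᴴ * X = diagonal ξ * (Aᴴ * A) * diagonal ξ := by
    rw [hX, conjTranspose_mul_self_of_eq_mul_diagonal, hstar]
  have hnorm : opNorm (Aᴴ * A) = cbB (Xᴴ * X) ↔ opNorm A = cbF X := by
    rw [opNorm_conjTranspose_mul_self, cbB_conjTranspose_mul_self]
    exact sq_eq_sq₀ (opNorm_nonneg A) (cbF_nonneg X)
  constructor
  · rintro ⟨-, -, hA, hcol, -⟩
    refine ⟨hξ, hξ, hξ2, hξ2, hnorm.2 hA, fun j hj i => ?_, fun i hi j => ?_, hfact⟩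
    · simp [Matrix.mul_apply, hcol j hj]
    · simp [Matrix.mul_apply, hcol i hi]
  · rintro ⟨-, -, -, -, hB, hcol, -, -⟩
    refine ⟨hξ, hξ2, hnorm.1 hB, fun j hj i => ?_, hX⟩
    have hz : star (fun i => A i j) ⬝ᵥ (fun i => A i j) = 0 := hcol j hj j
    exact congrFun (dotProduct_star_self_eq_zero.1 hz) i

end MatFact
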